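/- arXiv:0905.2271 — 2 statements merged into one kernel-verified Lean document; each statement's English description precedes it below -/
import Mathlib

section
/- Let H be a connected graded commutative Hopf algebra over ℂ and g_A its Lie algebra of infinitesimal characters with values in A = ℂ((λ)). Fix m, n ∈ ℤ, let L_0 ∈ g_A, and set X = 2λ^{−n+2m}L_0 (i.e. X(x) = 2λ^{−n+2m}·L_0(x)). Suppose g_±: ℝ → G_A are pointwise differentiable curves with g_±(0) = ε furnishing the Birkhoff factorization exp(−tX) = g_-(t)^{-1} ⋆ g_+(t). Then L(t) := Ad(g_±(t))L_0 satisfies dL/dt = [L, M] with M = R(λ^{−n+2m}L), where R = P_+ − P_- is applied to the A-valued entries. -/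
open scoped TensorProduct

set_option synthInstance.maxHeartbeats 1000000
set_option maxHeartbeats 1600000
set_option linter.unnecessarySeqFocus false

noncomputable section

/-- The algebra `A = ℂ((λ))` of formal Laurent series with finite pole part. -/
abbrev LS := LaurentSeries ℂ

/-- `ℂ`-scalars commute with multiplication of Laurent series. -/
instance : SMulCommClass ℂ LS LS := by
  constructor
  intro c a b
  show c • (a * b) = a * (c • b)
  rw [← HahnSeries.single_zero_mul_eq_smul, ← HahnSeries.single_zero_mul_eq_smul]
  ring

/-- Scalar tower for `ℂ`-scalars and Laurent series. -/
instance : IsScalarTower ℂ LS LS := by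
  constructor
  intro c a b
  show (c • a) * b = c • (a * b)
  rw [← HahnSeries.single_zero_mul_eq_smul, ← HahnSeries.single_zero_mul_eq_smul]
  ring

/-- `A₊ = ℂ[[λ]]`: the holomorphic part. -/
def Aplus (f : LS) : Prop := ∀ n : ℤ, n < 0 → f.coeff n = 0

/-- `A₋ = λ⁻¹ℂ[λ⁻¹]`: the polar part. -/
def Aminus (f : LS) : Prop := ∀ n : ℤ, 0 ≤ n → f.coeff n = 0

/-- The formal variable `λ`. -/
def lam : LS := HahnSeries.single (1 : ℤ) (1 : ℂ)

/-- `λ^k` for `k : ℤ`. -/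
def lamZ (k : ℤ) : LS := HahnSeries.single k (1 : ℂ)

/-- `e^{cλ} = Σ_k c^k λ^k / k!` as a Laurent series. -/
def expL (c : ℂ) : LS :=
  HahnSeries.ofPowerSeries ℤ ℂ (PowerSeries.mk fun k => c ^ k / (k.factorial : ℂ))

section Hopf

variable {H : Type} [Ring H] [HopfAlgebra ℂ H]

/-- Convolution product of linear maps from a Hopf algebra to `A`. -/
def conv (f g : H →ₗ[ℂ] LS) : H →ₗ[ℂ] LS :=
  LinearMap.mul' ℂ LS ∘ₗ TensorProduct.map f g ∘ₗ Coalgebra.comul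

/-- The unit `ε` of the convolution algebra. -/
def epsA : H →ₗ[ℂ] LS := LinearMap.toSpanSingleton ℂ LS 1 ∘ₗ Coalgebra.counit

/-- Characters: algebra morphisms `H → A` sending `1` to `1`. -/
def IsCharacter (φ : H →ₗ[ℂ] LS) : Prop :=
  φ 1 = 1 ∧ ∀ x y : H, φ (x * y) = φ x * φ y

/-- The group inverse of a character: `φ⁻¹ = φ ∘ S`. -/
def charInv (φ : H →ₗ[ℂ] LS) : H →ₗ[ℂ] LS := φ ∘ₗ HopfAlgebra.antipode (R := ℂ)

/-- Infinitesimal characters: `Z(xy) = Z(x)ε(y) + ε(x)Z(y)`. -/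
def IsInfChar (Z : H →ₗ[ℂ] LS) : Prop :=
  ∀ x y : H, Z (x * y) = Z x * epsA y + epsA x * Z y

/-- The Lie bracket `[Z,Z'] = Z⋆Z' − Z'⋆Z` on infinitesimal characters. -/
def lieBr (Z W : H →ₗ[ℂ] LS) : H →ₗ[ℂ] LS := conv Z W - conv W Z

/-- The adjoint action `Ad(g)L = g⋆L⋆g⁻¹`. -/
def Adc (g L : H →ₗ[ℂ] LS) : H →ₗ[ℂ] LS := conv g (conv L (charInv g))

/-- Convolution powers `Z^{⋆k}`. -/
def convPow (Z : H →ₗ[ℂ] LS) : ℕ → (H →ₗ[ℂ] LS)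
  | 0 => epsA
  | k + 1 => conv Z (convPow Z k)

/-- `E = exp(Z)`, the convolution exponential: for each `x ∈ H` the series
`Σ_k Z^{⋆k}(x)/k!` stabilizes (a finite sum by connectedness) with value `E(x)`. -/
def IsConvExp (Z E : H →ₗ[ℂ] LS) : Prop :=
  ∀ x : H, ∃ N : ℕ, ∀ M : ℕ, N ≤ M →
    E x = ∑ k ∈ Finset.range M, ((k.factorial : ℂ))⁻¹ • convPow Z k x

/- ℂ-valued (scalar) versions, for `β`-functions. -/

/-- Convolution product of ℂ-valued linear maps on a Hopf algebra. -/
def convC (f g : H →ₗ[ℂ] ℂ) : H →ₗ[ℂ] ℂ :=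
  LinearMap.mul' ℂ ℂ ∘ₗ TensorProduct.map f g ∘ₗ Coalgebra.comul

/-- ℂ-valued characters. -/
def IsCharacterC (φ : H →ₗ[ℂ] ℂ) : Prop :=
  φ 1 = 1 ∧ ∀ x y : H, φ (x * y) = φ x * φ y

/-- The group inverse of a ℂ-valued character. -/
def charInvC (φ : H →ₗ[ℂ] ℂ) : H →ₗ[ℂ] ℂ := φ ∘ₗ HopfAlgebra.antipode (R := ℂ)

/-- ℂ-valued infinitesimal characters. -/
def IsInfCharC (Z : H →ₗ[ℂ] ℂ) : Prop :=
  ∀ x y : H, Z (x * y) = Z x * Coalgebra.counit y + Coalgebra.counit x * Z y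

end Hopf

section Graded

variable {H : Type} [Ring H] [HopfAlgebra ℂ H]
variable (𝒜 : ℕ → Submodule ℂ H) [GradedAlgebra 𝒜]

/-- Connectedness: `H₀ = ℂ·1`. -/
def IsConnectedGrading : Prop := 𝒜 0 = Submodule.span ℂ {(1 : H)}

/-- The coproduct is grading-preserving: `Δ(H_n) ⊆ Σ_{i+j=n} H_i ⊗ H_j`. -/
def ComulGraded : Prop :=
  ∀ n : ℕ, ∀ x ∈ 𝒜 n, Coalgebra.comul (R := ℂ) x ∈
    ⨆ p : {p : ℕ × ℕ // p.1 + p.2 = n},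
      LinearMap.range (TensorProduct.map ((𝒜 p.1.1).subtype) ((𝒜 p.1.2).subtype))

/-- The counit is grading-preserving: it vanishes in positive degrees. -/
def CounitGraded : Prop := ∀ n : ℕ, 0 < n → ∀ x ∈ 𝒜 n, Coalgebra.counit (R := ℂ) x = 0

/-- The antipode is grading-preserving. -/
def AntipodeGraded : Prop := ∀ n : ℕ, ∀ x ∈ 𝒜 n, HopfAlgebra.antipode (R := ℂ) x ∈ 𝒜 n

/-- The grading biderivation `Y(x) = n·x` for `x ∈ H_n`. -/
def Ymap : H →ₗ[ℂ] H :=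
  (DFinsupp.lsum ℕ fun n : ℕ => ((n : ℂ) • (𝒜 n).subtype)) ∘ₗ
    (DirectSum.decomposeLinearEquiv 𝒜).toLinearMap

/-- `φ^t`, defined by `φ^t(x) = e^{tλn}·φ(x)` for homogeneous `x` of degree `n`. -/
def charScale (t : ℂ) (φ : H →ₗ[ℂ] LS) : H →ₗ[ℂ] LS :=
  (DFinsupp.lsum ℕ fun n : ℕ => (expL (t * (n : ℂ)) • (φ ∘ₗ (𝒜 n).subtype))) ∘ₗ
    (DirectSum.decomposeLinearEquiv 𝒜).toLinearMap

/-- `R̃(φ) = φ^{-1} ⋆ (φ ∘ Y)`. -/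
def Rtilde (φ : H →ₗ[ℂ] LS) : H →ₗ[ℂ] LS := conv (charInv φ) (φ ∘ₗ Ymap 𝒜)

/-- `(φm, φp)` is the Birkhoff decomposition of `φ`: `φ = φm^{-1} ⋆ φp`, i.e. `φm ⋆ φ = φp`,
with `φp` holomorphic and `φm − ε` a pure pole part. -/
def IsBirkhoff (φ φm φp : H →ₗ[ℂ] LS) : Prop :=
  IsCharacter φm ∧ IsCharacter φp ∧ (∀ x, Aplus (φp x)) ∧
    (∀ x, Aminus (φm x - epsA x)) ∧ conv φm φ = φp

/-- A character is local if the negative Birkhoff part of `φ^t` is independent of `t`. -/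
def IsLocal (φ : H →ₗ[ℂ] LS) : Prop :=
  IsCharacter φ ∧ ∃ φm : H →ₗ[ℂ] LS, ∀ t : ℂ, ∃ φp, IsBirkhoff (charScale 𝒜 t φ) φm φp

/-- `B = tildeβ_φ`:  `B(x) = (d/dt)|_{t=0} (φ^{-1} ⋆ φ^t)(x)`, coefficientwise. -/
def HasTildeBeta (φ B : H →ₗ[ℂ] LS) : Prop :=
  ∀ (x : H) (n : ℤ),
    HasDerivAt (fun t : ℂ => ((conv (charInv φ) (charScale 𝒜 t φ)) x).coeff n)
      ((B x).coeff n) 0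

/-- The `β`-function `β_φ = −(Res φ₋) ∘ Y` of a local character whose negative
Birkhoff part is `φm`. -/
def betaFn (φm : H →ₗ[ℂ] LS) : H → ℂ := fun x => -((φm (Ymap 𝒜 x)).coeff (-1))

end Graded

section Curves

variable {H : Type} [Ring H] [HopfAlgebra ℂ H]

/-- Pointwise (coefficientwise) derivative of a curve of maps `H → A`. -/
def HasDerivAtF (F : ℝ → (H →ₗ[ℂ] LS)) (F' : H →ₗ[ℂ] LS) (t : ℝ) : Prop :=
  ∀ (x : H) (n : ℤ), HasDerivAt (fun s : ℝ => ((F s) x).coeff n) ((F' x).coeff n) t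

/-- Pointwise differentiability of a curve of maps `H → A`. -/
def PointwiseDifferentiable (F : ℝ → (H →ₗ[ℂ] LS)) : Prop :=
  ∀ (x : H) (n : ℤ), Differentiable ℝ (fun s : ℝ => ((F s) x).coeff n)

end Curves

/-- The operator `R = P₊ − P₋` on Laurent series. -/
def Rop : LS →ₗ[ℂ] LS where
  toFun f :=
    { coeff := fun n => if n < 0 then -f.coeff n else f.coeff n
      isPWO_support' := f.isPWO_support'.mono (by
        intro n hn
        simp only [Function.mem_support] at hn ⊢
        by_cases h : n < 0 <;> simp_all) }
  map_add' f g := by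
    ext n
    by_cases h : n < 0 <;> simp [h] <;> ring
  map_smul' c f := by
    ext n
    by_cases h : n < 0 <;> simp [h]


section Helpers

open WithConv

/-- The coefficientwise algebra structure, compatible with the module structure in use. -/
local instance lsAlgebra : Algebra ℂ LS := HahnSeries.instAlgebra

section Laurent

/-- All coefficients below `a` vanish. -/
def LowB (a : ℤ) (f : LS) : Prop := ∀ i : ℤ, i < a → f.coeff i = 0

lemma coeff_mul_Icc {a b : ℤ} {f g : LS} (hf : LowB a f) (hg : LowB b g) (n : ℤ) :
    (f * g).coeff n = ∑ i ∈ Finset.Icc a (n - b), f.coeff i * g.coeff (n - i) := by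
  rw [HahnSeries.coeff_mul]
  refine Finset.sum_bij_ne_zero (fun p _ _ => p.1) ?_ ?_ ?_ ?_
  · intro p hp h0
    simp only [Finset.mem_antidiagonal, HahnSeries.mem_support] at hp
    obtain ⟨h1, h2, h3⟩ := hp
    rw [Finset.mem_Icc]
    constructor
    · by_contra h
      exact h1 (hf _ (by omega))
    · by_contra h
      exact h2 (hg _ (by omega))
  · intro p hp _ q hq _ h
    simp only [Finset.mem_antidiagonal] at hp hq
    ext
    · exact h
    · have := hp.2.2
      have := hq.2.2
      omega
  · intro i hi h0
    refine ⟨(i, n - i), ?_, h0, rfl⟩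
    simp only [Finset.mem_antidiagonal, HahnSeries.mem_support]
    exact ⟨left_ne_zero_of_mul h0, right_ne_zero_of_mul h0, by ring⟩
  · intro p hp h0
    simp only [Finset.mem_antidiagonal] at hp
    have : p.2 = n - p.1 := by omega
    rw [this]

lemma exists_lowB (f : LS) : ∃ a, LowB a f :=
  ⟨f.order, fun _ hi => HahnSeries.coeff_eq_zero_of_lt_order hi⟩

lemma LowB.mul {a b : ℤ} {f g : LS} (hf : LowB a f) (hg : LowB b g) : LowB (a + b) (f * g) := by
  intro n hn
  rw [coeff_mul_Icc hf hg, Finset.Icc_eq_empty (by omega), Finset.sum_empty]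

lemma LowB.mono {a b : ℤ} {f : LS} (hf : LowB a f) (h : b ≤ a) : LowB b f :=
  fun i hi => hf i (by omega)

lemma Aminus.mul_le {f g : LS} (hf : Aminus f) (hg : ∀ n : ℤ, 0 < n → g.coeff n = 0) :
    Aminus (f * g) := by
  obtain ⟨a, ha⟩ := exists_lowB f
  obtain ⟨b, hb⟩ := exists_lowB g
  intro n hn
  rw [coeff_mul_Icc ha hb]
  refine Finset.sum_eq_zero fun i _ => ?_
  by_cases h : 0 ≤ i
  · rw [hf i h, zero_mul]
  · rw [hg _ (by omega), mul_zero]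

lemma coeff_sum_LS {ι : Type*} (s : Finset ι) (f : ι → LS) (n : ℤ) :
    (∑ i ∈ s, f i).coeff n = ∑ i ∈ s, (f i).coeff n := by
  classical
  induction s using Finset.induction_on with
  | empty => simp
  | insert a s ha ih => rw [Finset.sum_insert ha, Finset.sum_insert ha, HahnSeries.coeff_add, ih]

end Laurent

section ConvAlg

variable {H : Type} [CommRing H] [HopfAlgebra ℂ H]

lemma toConv_conv (f g : H →ₗ[ℂ] LS) : toConv (conv f g) = toConv f * toConv g := rfl

lemma toConv_epsA : toConv (epsA : H →ₗ[ℂ] LS) = 1 := by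
  apply WithConv.ext
  ext x : 1
  show (LinearMap.toSpanSingleton ℂ LS 1) (Coalgebra.counit (R := ℂ) x)
    = algebraMap ℂ LS (Coalgebra.counit (R := ℂ) x)
  rw [LinearMap.toSpanSingleton_apply, Algebra.algebraMap_eq_smul_one]

lemma conv_apply_repr (f g : H →ₗ[ℂ] LS) (x : H) :
    conv f g x = ∑ i ∈ (Coalgebra.Repr.arbitrary ℂ x).index,
      f ((Coalgebra.Repr.arbitrary ℂ x).left i) * g ((Coalgebra.Repr.arbitrary ℂ x).right i) :=
  (Coalgebra.Repr.arbitrary ℂ x).convMul_apply (toConv f) (toConv g)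

/-- A character as an algebra morphism. -/
def charHom (φ : H →ₗ[ℂ] LS) (h : IsCharacter φ) : H →ₐ[ℂ] LS := AlgHom.ofLinearMap φ h.1 h.2

lemma charInv_mul {φ : H →ₗ[ℂ] LS} (h : IsCharacter φ) : toConv (charInv φ) * toConv φ = 1 := by
  rw [← toConv_epsA, ← toConv_conv]
  congr 1
  ext x : 1
  rw [conv_apply_repr]
  have := HopfAlgebra.sum_antipode_mul_eq_algebraMap_counit (R := ℂ) (Coalgebra.Repr.arbitrary ℂ x)
  have h2 := congrArg (charHom φ h) this
  rw [map_sum, AlgHom.commutes] at h2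
  simp only [map_mul] at h2
  refine h2.trans ?_
  rw [Algebra.algebraMap_eq_smul_one]
  rfl

lemma mul_charInv {φ : H →ₗ[ℂ] LS} (h : IsCharacter φ) : toConv φ * toConv (charInv φ) = 1 := by
  rw [← toConv_epsA, ← toConv_conv]
  congr 1
  ext x : 1
  rw [conv_apply_repr]
  have := HopfAlgebra.sum_mul_antipode_eq_algebraMap_counit (R := ℂ) (Coalgebra.Repr.arbitrary ℂ x)
  have h2 := congrArg (charHom φ h) this
  rw [map_sum, AlgHom.commutes] at h2
  simp only [map_mul] at h2
  refine h2.trans ?_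
  rw [Algebra.algebraMap_eq_smul_one]
  rfl

lemma isCharacter_charInv {φ : H →ₗ[ℂ] LS} (h : IsCharacter φ) : IsCharacter (charInv φ) := by
  refine ⟨?_, fun x y => ?_⟩
  · show φ (HopfAlgebra.antipode ℂ (1 : H)) = 1
    rw [HopfAlgebra.antipode_one, h.1]
  · show φ (HopfAlgebra.antipode ℂ (x * y)) = _
    rw [HopfAlgebra.antipode_mul_distrib, h.2]
    rfl

lemma isCharacter_conv {φ ψ : H →ₗ[ℂ] LS} (h : IsCharacter φ) (h' : IsCharacter ψ) :
    IsCharacter (conv φ ψ) := by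
  have : conv φ ψ = (toConv (charHom φ h) * toConv (charHom ψ h')).ofConv.toLinearMap := by
    have := AlgHom.toLinearMap_convMul (toConv (charHom φ h)) (toConv (charHom ψ h'))
    exact (congrArg WithConv.ofConv this).symm
  rw [this]
  exact ⟨map_one (toConv (charHom φ h) * toConv (charHom ψ h')).ofConv,
    map_mul (toConv (charHom φ h) * toConv (charHom ψ h')).ofConv⟩

lemma toConv_Adc (g L : H →ₗ[ℂ] LS) :
    toConv (Adc g L) = toConv g * (toConv L * toConv (charInv g)) := rfl

lemma toConv_convPow (Z : H →ₗ[ℂ] LS) (k : ℕ) : toConv (convPow Z k) = toConv Z ^ k := by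
  induction k with
  | zero => rw [pow_zero]; exact toConv_epsA
  | succ k ih => rw [pow_succ', ← ih]; rfl

/-- Truncated exponential. -/
def truncExp (Z : H →ₗ[ℂ] LS) (M : ℕ) : H →ₗ[ℂ] LS :=
  ∑ k ∈ Finset.range M, ((k.factorial : ℂ))⁻¹ • convPow Z k

lemma truncExp_apply (Z : H →ₗ[ℂ] LS) (M : ℕ) (x : H) :
    truncExp Z M x = ∑ k ∈ Finset.range M, ((k.factorial : ℂ))⁻¹ • convPow Z k x := by
  simp [truncExp, LinearMap.sum_apply]

lemma convExp_right {Z E : H →ₗ[ℂ] LS} (h : IsConvExp Z E) (f : H →ₗ[ℂ] LS) (x : H) :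
    ∃ N, ∀ M, N ≤ M → conv f E x = conv f (truncExp Z M) x := by
  choose N hN using h
  refine ⟨(Coalgebra.Repr.arbitrary ℂ x).index.sup
    fun i => N ((Coalgebra.Repr.arbitrary ℂ x).right i), fun M hM => ?_⟩
  rw [conv_apply_repr, conv_apply_repr]
  refine Finset.sum_congr rfl fun i hi => ?_
  rw [truncExp_apply, ← hN]
  exact (Finset.le_sup (f := fun i => N ((Coalgebra.Repr.arbitrary ℂ x).right i)) hi).trans hM

lemma convExp_left {Z E : H →ₗ[ℂ] LS} (h : IsConvExp Z E) (f : H →ₗ[ℂ] LS) (x : H) :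
    ∃ N, ∀ M, N ≤ M → conv E f x = conv (truncExp Z M) f x := by
  choose N hN using h
  refine ⟨(Coalgebra.Repr.arbitrary ℂ x).index.sup
    fun i => N ((Coalgebra.Repr.arbitrary ℂ x).left i), fun M hM => ?_⟩
  rw [conv_apply_repr, conv_apply_repr]
  refine Finset.sum_congr rfl fun i hi => ?_
  rw [truncExp_apply, ← hN]
  exact (Finset.le_sup (f := fun i => N ((Coalgebra.Repr.arbitrary ℂ x).left i)) hi).trans hM

lemma toConv_sum' {ι : Type*} (s : Finset ι) (f : ι → (H →ₗ[ℂ] LS)) :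
    toConv (∑ i ∈ s, f i) = ∑ i ∈ s, toConv (f i) :=
  map_sum (WithConv.addEquiv (H →ₗ[ℂ] LS)).symm f s

lemma convExp_commute {Z E f : H →ₗ[ℂ] LS} (h : IsConvExp Z E)
    (hc : Commute (toConv f) (toConv Z)) : Commute (toConv f) (toConv E) := by
  have key : conv f E = conv E f := by
    ext x : 1
    obtain ⟨N, hN⟩ := convExp_right h f x
    obtain ⟨N', hN'⟩ := convExp_left h f x
    rw [hN (max N N') (le_max_left _ _), hN' (max N N') (le_max_right _ _)]
    have : Commute (toConv f) (toConv (truncExp Z (max N N'))) := by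
      rw [truncExp, toConv_sum']
      refine Commute.sum_right (R := WithConv (H →ₗ[ℂ] LS)) _ _ _ fun k _ => ?_
      rw [toConv_smul, toConv_convPow]
      exact (hc.pow_right k).smul_right _
    have h2 : conv f (truncExp Z (max N N')) = conv (truncExp Z (max N N')) f :=
      congrArg WithConv.ofConv this.eq
    rw [h2]
  exact congrArg toConv key

end ConvAlg

section CurveLemmas

variable {H : Type} [CommRing H] [HopfAlgebra ℂ H]

/-- Pole orders bounded uniformly along the curve. -/
def UnifB (F : ℝ → (H →ₗ[ℂ] LS)) : Prop := ∀ x, ∃ a : ℤ, ∀ s, LowB a (F s x)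

lemma unifB_const (f : H →ₗ[ℂ] LS) : UnifB (fun _ => f) := by
  intro x
  obtain ⟨a, ha⟩ := exists_lowB (f x)
  exact ⟨a, fun _ => ha⟩

lemma UnifB.charInv {F : ℝ → (H →ₗ[ℂ] LS)} (h : UnifB F) : UnifB (fun s => charInv (F s)) :=
  fun x => h (HopfAlgebra.antipode ℂ x)

lemma finset_lower {ι : Type*} (s : Finset ι) (f : ι → ℤ) : ∃ c, ∀ i ∈ s, c ≤ f i := by
  classical
  induction s using Finset.induction_on with
  | empty => exact ⟨0, by simp⟩
  | insert a s ha ih =>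
    obtain ⟨c, hc⟩ := ih
    refine ⟨min c (f a), fun i hi => ?_⟩
    rcases Finset.mem_insert.1 hi with rfl | hi
    · exact min_le_right _ _
    · exact (min_le_left _ _).trans (hc i hi)

lemma UnifB.conv {F G : ℝ → (H →ₗ[ℂ] LS)} (hF : UnifB F) (hG : UnifB G) :
    UnifB (fun s => conv (F s) (G s)) := by
  intro x
  choose a ha using hF
  choose b hb using hG
  obtain ⟨c, hc⟩ := finset_lower (Coalgebra.Repr.arbitrary ℂ x).index
    (fun i => a ((Coalgebra.Repr.arbitrary ℂ x).left i) + b ((Coalgebra.Repr.arbitrary ℂ x).right i))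
  refine ⟨c, fun s n hn => ?_⟩
  simp only [conv_apply_repr]
  rw [coeff_sum_LS]
  exact Finset.sum_eq_zero fun i hi => (((ha _ s).mul (hb _ s)).mono (hc i hi)) n hn

lemma hasDeriv_lowB {F : ℝ → (H →ₗ[ℂ] LS)} {F' : H →ₗ[ℂ] LS} {t : ℝ} (h : HasDerivAtF F F' t)
    {x : H} {a : ℤ} (ha : ∀ s, LowB a (F s x)) : LowB a (F' x) := by
  intro i hi
  have h1 := h x i
  have h2 : (fun s : ℝ => ((F s) x).coeff i) = fun _ => (0 : ℂ) := by
    funext s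
    exact ha s i hi
  rw [h2] at h1
  exact h1.unique (hasDerivAt_const t (0 : ℂ))

lemma HasDerivAtF.conv {F G : ℝ → (H →ₗ[ℂ] LS)} {F' G' : H →ₗ[ℂ] LS} {t : ℝ}
    (hF : UnifB F) (hG : UnifB G) (dF : HasDerivAtF F F' t) (dG : HasDerivAtF G G' t) :
    HasDerivAtF (fun s => conv (F s) (G s)) (conv F' (G t) + conv (F t) G') t := by
  intro x n
  choose a ha using hF
  choose b hb using hG
  have e : (fun s : ℝ => (_root_.conv (F s) (G s) x).coeff n) = fun s : ℝ =>
      ∑ i ∈ (Coalgebra.Repr.arbitrary ℂ x).index,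
        ∑ j ∈ Finset.Icc (a ((Coalgebra.Repr.arbitrary ℂ x).left i))
            (n - b ((Coalgebra.Repr.arbitrary ℂ x).right i)),
          (F s ((Coalgebra.Repr.arbitrary ℂ x).left i)).coeff j *
            (G s ((Coalgebra.Repr.arbitrary ℂ x).right i)).coeff (n - j) := by
    funext s
    rw [conv_apply_repr, coeff_sum_LS]
    exact Finset.sum_congr rfl fun i _ => coeff_mul_Icc (ha _ s) (hb _ s) n
  have e' : ((_root_.conv F' (G t) + _root_.conv (F t) G') x).coeff n =
      ∑ i ∈ (Coalgebra.Repr.arbitrary ℂ x).index,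
        ∑ j ∈ Finset.Icc (a ((Coalgebra.Repr.arbitrary ℂ x).left i))
            (n - b ((Coalgebra.Repr.arbitrary ℂ x).right i)),
          ((F' ((Coalgebra.Repr.arbitrary ℂ x).left i)).coeff j *
            (G t ((Coalgebra.Repr.arbitrary ℂ x).right i)).coeff (n - j) +
          (F t ((Coalgebra.Repr.arbitrary ℂ x).left i)).coeff j *
            (G' ((Coalgebra.Repr.arbitrary ℂ x).right i)).coeff (n - j)) := by
    rw [LinearMap.add_apply, HahnSeries.coeff_add, conv_apply_repr, conv_apply_repr,
      coeff_sum_LS, coeff_sum_LS, ← Finset.sum_add_distrib]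
    refine Finset.sum_congr rfl fun i _ => ?_
    rw [coeff_mul_Icc (hasDeriv_lowB dF (ha _)) (hb _ t) n,
      coeff_mul_Icc (ha _ t) (hasDeriv_lowB dG (hb _)) n, ← Finset.sum_add_distrib]
  rw [e, e']
  exact HasDerivAt.fun_sum fun i _ => HasDerivAt.fun_sum fun j _ => (dF _ _).mul (dG _ _)

lemma HasDerivAtF.charInv {F : ℝ → (H →ₗ[ℂ] LS)} {F' : H →ₗ[ℂ] LS} {t : ℝ}
    (h : HasDerivAtF F F' t) : HasDerivAtF (fun s => charInv (F s)) (charInv F') t :=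
  fun x n => h (HopfAlgebra.antipode ℂ x) n

lemma hasDerivAtF_const (f : H →ₗ[ℂ] LS) (t : ℝ) : HasDerivAtF (fun _ => f) 0 t := by
  intro x n
  simpa using hasDerivAt_const t ((f x).coeff n)

lemma HasDerivAtF.unique {F : ℝ → (H →ₗ[ℂ] LS)} {F' F'' : H →ₗ[ℂ] LS} {t : ℝ}
    (h : HasDerivAtF F F' t) (h' : HasDerivAtF F F'' t) : F' = F'' := by
  ext x n
  exact (h x n).unique (h' x n)

lemma exists_hasDerivAtF {F : ℝ → (H →ₗ[ℂ] LS)} (hF : UnifB F) (hd : PointwiseDifferentiable F)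
    (t : ℝ) : ∃ F', HasDerivAtF F F' t := by
  have hsup : ∀ x : H, (Function.support fun n : ℤ =>
      deriv (fun s : ℝ => ((F s) x).coeff n) t).IsPWO := by
    intro x
    obtain ⟨a, ha⟩ := hF x
    refine Set.IsWF.isPWO (BddBelow.isWF ⟨a, fun i hi => ?_⟩)
    by_contra hlt
    apply hi
    have h2 : (fun s : ℝ => ((F s) x).coeff i) = fun _ => (0 : ℂ) := by
      funext s
      exact ha s i (by omega)
    simp only [h2, deriv_const]
  refine ⟨
    { toFun := fun x => ⟨fun n => deriv (fun s : ℝ => ((F s) x).coeff n) t, hsup x⟩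
      map_add' := fun x y => ?_
      map_smul' := fun c x => ?_ }, fun x n => (hd x n t).hasDerivAt⟩
  · ext n
    simp only [map_add, HahnSeries.coeff_add]
    exact deriv_fun_add (hd x n t) (hd y n t)
  · ext n
    simp only [map_smul, HahnSeries.coeff_smul, RingHom.id_apply]
    exact deriv_fun_const_smul c (hd x n t)

end CurveLemmas

section Main

variable {H : Type} [CommRing H] [HopfAlgebra ℂ H]

lemma convPow_smul' (c : ℂ) (Z : H →ₗ[ℂ] LS) (k : ℕ) : convPow (c • Z) k = c ^ k • convPow Z k := by
  apply toConv_injective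
  rw [toConv_smul, toConv_convPow, toConv_convPow, toConv_smul, smul_pow]

lemma convExp_uniform {X : H →ₗ[ℂ] LS} {E : ℝ → (H →ₗ[ℂ] LS)}
    (h : ∀ t : ℝ, IsConvExp ((-(t : ℂ)) • X) (E t)) (x : H) :
    ∃ N, ∀ M, N ≤ M → ∀ t : ℝ,
      E t x = ∑ k ∈ Finset.range M, ((k.factorial : ℂ))⁻¹ • (-(t : ℂ)) ^ k • convPow X k x := by
  obtain ⟨N, hN⟩ := h 1 x
  have hz : ∀ k, N ≤ k → convPow X k x = 0 := by
    intro k hk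
    have h1 := hN k hk
    have h2 := hN (k + 1) (by omega)
    rw [Finset.sum_range_succ, ← h1] at h2
    have h3 : ((k.factorial : ℂ))⁻¹ • convPow ((-((1 : ℝ) : ℂ)) • X) k x = 0 := by
      simpa using h2
    rw [convPow_smul', LinearMap.smul_apply, smul_smul] at h3
    refine (smul_eq_zero.1 h3).resolve_left ?_
    refine mul_ne_zero (inv_ne_zero (by exact_mod_cast k.factorial_ne_zero)) (pow_ne_zero _ ?_)
    norm_num
  refine ⟨N, fun M hM t => ?_⟩
  obtain ⟨N', hN'⟩ := h t x
  rw [hN' (max M N') (le_max_right _ _)]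
  simp only [convPow_smul', LinearMap.smul_apply]
  symm
  refine Finset.sum_subset (Finset.range_mono (le_max_left _ _)) fun k _ hk => ?_
  rw [hz k (by rw [Finset.mem_range] at hk; omega), smul_zero, smul_zero]

lemma convExp_unifB {X : H →ₗ[ℂ] LS} {E : ℝ → (H →ₗ[ℂ] LS)}
    (h : ∀ t : ℝ, IsConvExp ((-(t : ℂ)) • X) (E t)) : UnifB E := by
  intro x
  obtain ⟨N, hN⟩ := convExp_uniform h x
  choose a ha using fun k => exists_lowB (convPow X k x)
  obtain ⟨c, hc⟩ := finset_lower (Finset.range N) a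
  refine ⟨c, fun s n hn => ?_⟩
  rw [hN N le_rfl s, coeff_sum_LS]
  refine Finset.sum_eq_zero fun k hk => ?_
  rw [HahnSeries.coeff_smul, HahnSeries.coeff_smul, ha k n (lt_of_lt_of_le hn (hc k hk)), smul_zero,
    smul_zero]

lemma conv_truncExp (c : ℂ) (X : H →ₗ[ℂ] LS) (M : ℕ) (x : H) :
    conv X (truncExp (c • X) M) x =
      ∑ k ∈ Finset.range M, ((k.factorial : ℂ))⁻¹ • c ^ k • convPow X (k + 1) x := by
  have : conv X (truncExp (c • X) M) =
      ∑ k ∈ Finset.range M, ((k.factorial : ℂ))⁻¹ • c ^ k • convPow X (k + 1) := by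
    apply toConv_injective
    rw [toConv_conv, truncExp, toConv_sum', toConv_sum']
    refine (Finset.mul_sum (R := WithConv (H →ₗ[ℂ] LS)) _ _ _).trans ?_
    refine Finset.sum_congr rfl fun k _ => ?_
    rw [convPow_smul', toConv_smul, toConv_smul, toConv_smul, toConv_smul, mul_smul_comm,
      mul_smul_comm]
    rfl
  rw [this]
  simp [LinearMap.sum_apply]

lemma convExp_hasDeriv {X : H →ₗ[ℂ] LS} {E : ℝ → (H →ₗ[ℂ] LS)}
    (h : ∀ t : ℝ, IsConvExp ((-(t : ℂ)) • X) (E t)) (t : ℝ) :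
    HasDerivAtF E (-(conv X (E t))) t := by
  intro x n
  obtain ⟨N, hN⟩ := convExp_uniform h x
  obtain ⟨N', hN'⟩ := convExp_right (h t) X x
  have e : (fun s : ℝ => (E s x).coeff n) = fun s : ℝ =>
      ∑ k ∈ Finset.range (max N N' + 1),
        ((k.factorial : ℂ))⁻¹ * ((-(s : ℂ)) ^ k * (convPow X k x).coeff n) := by
    funext s
    rw [hN (max N N' + 1) ((le_max_left _ _).trans (Nat.le_succ _)) s, coeff_sum_LS]
    simp [HahnSeries.coeff_smul]
  have e' : ((-(conv X (E t))) x).coeff n = ∑ k ∈ Finset.range (max N N' + 1),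
        ((k.factorial : ℂ))⁻¹ * ((k * (-(t : ℂ)) ^ (k - 1) * (-1)) * (convPow X k x).coeff n) := by
    rw [Finset.sum_range_succ', LinearMap.neg_apply, hN' (max N N') (le_max_right _ _),
      conv_truncExp, HahnSeries.coeff_neg, coeff_sum_LS, ← Finset.sum_neg_distrib]
    simp only [Nat.cast_zero, zero_mul, mul_zero, add_zero]
    refine Finset.sum_congr rfl fun k _ => ?_
    rw [HahnSeries.coeff_smul, HahnSeries.coeff_smul, Nat.factorial_succ]
    have h1 : ((k : ℂ) + 1) ≠ 0 := by exact_mod_cast Nat.succ_ne_zero k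
    have h2 : ((k.factorial : ℂ)) ≠ 0 := by exact_mod_cast k.factorial_ne_zero
    simp only [smul_eq_mul, Nat.cast_mul, Nat.cast_add, Nat.cast_one, Nat.add_sub_cancel]
    field_simp
  rw [e, e']
  refine HasDerivAt.fun_sum fun k _ => ?_
  have hd : HasDerivAt (fun s : ℝ => -(s : ℂ)) (-1) t := (Complex.ofRealCLM.hasDerivAt (x := t)).neg
  exact ((hd.pow k).mul_const _).const_mul _

lemma epsA_coeff (x : H) (n : ℤ) (hn : n ≠ 0) : (epsA x : LS).coeff n = 0 := by
  show ((Coalgebra.counit (R := ℂ) x) • (1 : LS)).coeff n = 0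
  rw [HahnSeries.coeff_smul, HahnSeries.coeff_one, if_neg hn, smul_zero]

lemma Rop_coeff (f : LS) (n : ℤ) : (Rop f).coeff n = if n < 0 then -f.coeff n else f.coeff n := rfl

lemma conv_ls_smul_left (a : LS) (f g : H →ₗ[ℂ] LS) : conv (a • f) g = a • conv f g := by
  ext x : 1
  rw [LinearMap.smul_apply, conv_apply_repr, conv_apply_repr, Finset.smul_sum]
  refine Finset.sum_congr rfl fun i _ => ?_
  rw [LinearMap.smul_apply, smul_eq_mul, smul_eq_mul, mul_assoc]

lemma conv_ls_smul_right (a : LS) (f g : H →ₗ[ℂ] LS) : conv f (a • g) = a • conv f g := by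
  ext x : 1
  rw [LinearMap.smul_apply, conv_apply_repr, conv_apply_repr, Finset.smul_sum]
  refine Finset.sum_congr rfl fun i _ => ?_
  rw [LinearMap.smul_apply, smul_eq_mul, smul_eq_mul, mul_left_comm]

/-- The convolution ring, sealed. -/
def CV (H : Type) [CommRing H] [HopfAlgebra ℂ H] : Type := WithConv (H →ₗ[ℂ] LS)

instance : Ring (CV H) := LinearMap.convRing (R := ℂ) (A := LS) (C := H)

/-- A linear map as an element of the convolution ring. -/
def cv (f : H →ₗ[ℂ] LS) : CV H := toConv f

lemma cv_inj {f g : H →ₗ[ℂ] LS} (h : cv f = cv g) : f = g := toConv_injective h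
lemma cv_conv (f g : H →ₗ[ℂ] LS) : cv (conv f g) = cv f * cv g := rfl
lemma cv_add (f g : H →ₗ[ℂ] LS) : cv (f + g) = cv f + cv g := rfl
lemma cv_sub (f g : H →ₗ[ℂ] LS) : cv (f - g) = cv f - cv g := rfl
lemma cv_neg (f : H →ₗ[ℂ] LS) : cv (-f) = -cv f := rfl
lemma cv_zero : cv (0 : H →ₗ[ℂ] LS) = 0 := rfl
lemma cv_eps : cv (epsA : H →ₗ[ℂ] LS) = 1 := toConv_epsA
lemma cv_two (f : H →ₗ[ℂ] LS) : cv ((2 : ℂ) • f) = cv f + cv f := by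
  rw [two_smul, cv_add]
lemma cv_surj (z : CV H) : ∃ f, cv f = z := ⟨WithConv.ofConv z, rfl⟩
lemma cv_smul (a : LS) (f : H →ₗ[ℂ] LS) : cv (a • f) = cv (a • epsA) * cv f := by
  rw [← cv_conv, conv_ls_smul_left]
  congr 2
  apply cv_inj
  rw [cv_conv, cv_eps, one_mul]
lemma cv_central (a : LS) (z : CV H) : z * cv (a • epsA) = cv (a • epsA) * z := by
  obtain ⟨f, rfl⟩ := cv_surj z
  rw [← cv_smul, ← cv_conv, conv_ls_smul_right]
  congr 2
  apply cv_inj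
  rw [cv_conv, cv_eps, mul_one]
lemma cv_charInv {φ : H →ₗ[ℂ] LS} (h : IsCharacter φ) : cv φ * cv (charInv φ) = 1 := mul_charInv h
lemma cv_charInv' {φ : H →ₗ[ℂ] LS} (h : IsCharacter φ) : cv (charInv φ) * cv φ = 1 := charInv_mul h
lemma cv_Adc (g L : H →ₗ[ℂ] LS) : cv (Adc g L) = cv g * (cv L * cv (charInv g)) := rfl

theorem lax_aux (k : ℤ) (L0 : H →ₗ[ℂ] LS)
    (gm gp : ℝ → (H →ₗ[ℂ] LS))
    (hgmchar : ∀ t, IsCharacter (gm t)) (hgpchar : ∀ t, IsCharacter (gp t))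
    (hgpplus : ∀ t x, Aplus (gp t x))
    (hgmminus : ∀ t x, Aminus (gm t x - epsA x))
    (hdm : PointwiseDifferentiable gm) (hdp : PointwiseDifferentiable gp)
    (hfact : ∀ t : ℝ,
      IsConvExp ((-(t : ℂ)) • ((2 : ℂ) • (lamZ k • L0)))
        (conv (charInv (gm t)) (gp t))) :
    (∀ t : ℝ, Adc (gm t) L0 = Adc (gp t) L0) ∧
    ∀ t : ℝ, HasDerivAtF (fun s : ℝ => Adc (gp s) L0)
      (lieBr (Adc (gp t) L0)
        (Rop ∘ₗ (lamZ k • Adc (gp t) L0))) t := by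
  have hcomm : ∀ t, Commute (toConv L0) (toConv (conv (charInv (gm t)) (gp t))) := by
    intro t
    refine convExp_commute (hfact t) ?_
    simp only [toConv_smul]
    refine Commute.smul_right (Commute.smul_right ?_ _) _
    have := conv_ls_smul_right (lamZ k) L0 L0
    rw [← conv_ls_smul_left] at this
    exact congrArg toConv this
  have hAd : ∀ t : ℝ, Adc (gm t) L0 = Adc (gp t) L0 := by
    intro t
    apply cv_inj
    rw [cv_Adc, cv_Adc]
    have h : cv L0 * (cv (charInv (gm t)) * cv (gp t)) = cv (charInv (gm t)) * cv (gp t) * cv L0 :=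
      (hcomm t).eq
    clear hcomm
    have h1 := cv_charInv (hgmchar t)
    have h3 := cv_charInv (hgpchar t)
    generalize cv L0 = l at *
    generalize cv (gm t) = b at *
    generalize cv (charInv (gm t)) = b' at *
    generalize cv (gp t) = a at *
    generalize cv (charInv (gp t)) = a' at *
    calc b * (l * b') = b * (l * (b' * (a * a'))) := by rw [h3, mul_one]
      _ = b * (l * (b' * a)) * a' := by simp only [mul_assoc]
      _ = b * b' * (a * (l * a')) := by rw [h]; simp only [mul_assoc]
      _ = a * (l * a') := by rw [h1, one_mul]
  refine ⟨hAd, fun t => ?_⟩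
  have uE : UnifB (fun s => conv (charInv (gm s)) (gp s)) := convExp_unifB hfact
  have ugp : UnifB gp := fun x => ⟨0, fun s i hi => hgpplus s x i hi⟩
  have egm : gm = fun s => conv (gp s) (charInv (conv (charInv (gm s)) (gp s))) := by
    funext s
    apply cv_inj
    have h1 := cv_charInv (hgmchar s)
    have h2 := cv_charInv (isCharacter_conv (isCharacter_charInv (hgmchar s)) (hgpchar s))
    rw [cv_conv] at h2 ⊢
    calc cv (gm s) = cv (gm s) * 1 := (mul_one _).symm
      _ = _ := by rw [← h2, ← mul_assoc, ← mul_assoc, h1, one_mul]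
  have ugm : UnifB gm := by
    rw [egm]
    exact ugp.conv uE.charInv
  obtain ⟨gm', dgm⟩ := exists_hasDerivAtF ugm hdm t
  obtain ⟨gp', dgp⟩ := exists_hasDerivAtF ugp hdp t
  have egp : (fun s => conv (gm s) (conv (charInv (gm s)) (gp s))) = gp := by
    funext s
    apply cv_inj
    rw [cv_conv, cv_conv, ← mul_assoc, cv_charInv (hgmchar s), one_mul]
  have d1 := HasDerivAtF.conv ugm uE dgm (convExp_hasDeriv hfact t)
  simp only [egp] at d1
  have e1 := congrArg cv (dgp.unique d1)
  have d2 := HasDerivAtF.conv ugp ugp.charInv dgp dgp.charInv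
  have eeps : (fun s => conv (gp s) (charInv (gp s))) = fun _ => epsA := by
    funext s
    apply cv_inj
    rw [cv_conv, cv_charInv (hgpchar s), cv_eps]
  simp only [eeps] at d2
  have e2 := congrArg cv (d2.unique (hasDerivAtF_const epsA t))
  have dL := HasDerivAtF.conv ugp ((unifB_const L0).conv ugp.charInv) dgp
    (HasDerivAtF.conv (unifB_const L0) ugp.charInv (hasDerivAtF_const L0 t) dgp.charInv)
  -- signs of the logarithmic derivatives
  have hP : ∀ x, Aplus (conv gp' (charInv (gp t)) x) := by
    intro x j hj
    rw [conv_apply_repr, coeff_sum_LS]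
    refine Finset.sum_eq_zero fun i _ => ?_
    have hl : LowB 0 (gp' ((Coalgebra.Repr.arbitrary ℂ x).left i)) :=
      hasDeriv_lowB dgp fun s i hi => hgpplus s _ i hi
    have hr : LowB 0 (charInv (gp t) ((Coalgebra.Repr.arbitrary ℂ x).right i)) :=
      fun i hi => hgpplus t _ i hi
    exact hl.mul hr j (by simpa using hj)
  have hQ : ∀ x, Aminus (conv gm' (charInv (gm t)) x) := by
    intro x j hj
    rw [conv_apply_repr, coeff_sum_LS]
    refine Finset.sum_eq_zero fun i _ => ?_
    have hl : Aminus (gm' ((Coalgebra.Repr.arbitrary ℂ x).left i)) := by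
      intro q hq
      have h1 := dgm ((Coalgebra.Repr.arbitrary ℂ x).left i) q
      have h2 : (fun s : ℝ => (gm s ((Coalgebra.Repr.arbitrary ℂ x).left i)).coeff q) =
          fun _ => (epsA ((Coalgebra.Repr.arbitrary ℂ x).left i) : LS).coeff q := by
        funext s
        have := hgmminus s ((Coalgebra.Repr.arbitrary ℂ x).left i) q hq
        rw [HahnSeries.coeff_sub] at this
        exact sub_eq_zero.1 this
      rw [h2] at h1
      exact h1.unique (hasDerivAt_const t _)
    refine hl.mul_le (fun q hq => ?_) j hj
    have := hgmminus t (HopfAlgebra.antipode ℂ ((Coalgebra.Repr.arbitrary ℂ x).right i)) q hq.le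
    rw [HahnSeries.coeff_sub, epsA_coeff _ _ hq.ne', sub_zero] at this
    exact this
  -- the splitting of `2 λ^k L`
  have hsplit : conv gp' (charInv (gp t)) =
      conv gm' (charInv (gm t)) - (2 : ℂ) • (lamZ k • Adc (gp t) L0) := by
    rw [← hAd t]
    apply cv_inj
    rw [cv_sub, cv_two, cv_smul, cv_conv, cv_conv, cv_Adc, e1]
    have h3 := cv_charInv (hgpchar t)
    rw [cv_add, cv_conv, cv_conv, cv_conv, cv_neg, cv_conv, cv_two, cv_smul, cv_conv]
    have hc := cv_central (H := H) (lamZ k) (cv (gm t))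
    clear e1 e2
    generalize cv (lamZ k • (epsA : H →ₗ[ℂ] LS)) = Λ at *
    generalize cv L0 = l at *
    generalize cv (gm t) = b at *
    generalize cv (charInv (gm t)) = b' at *
    generalize cv (gp t) = a at *
    generalize cv (charInv (gp t)) = a' at *
    have h4 : ∀ z, z * (b' * a) * a' = z * b' := by
      intro z
      rw [mul_assoc, mul_assoc, h3, mul_one]
    rw [add_mul, h4, mul_neg, neg_mul, ← mul_assoc, h4, ← sub_eq_add_neg]
    rw [mul_add, add_mul, ← mul_assoc b Λ, hc]
    simp only [mul_assoc]
  have hM : (Rop ∘ₗ (lamZ k • Adc (gp t) L0)) =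
      -(conv gp' (charInv (gp t))) - lamZ k • Adc (gp t) L0 := by
    ext x j
    have hs := congrArg (fun f : H →ₗ[ℂ] LS => (f x).coeff j) hsplit
    simp only [LinearMap.sub_apply, LinearMap.smul_apply, two_smul, LinearMap.add_apply,
      HahnSeries.coeff_add, HahnSeries.coeff_sub] at hs
    simp only [LinearMap.comp_apply, Rop_coeff, LinearMap.sub_apply, LinearMap.neg_apply,
      HahnSeries.coeff_sub, HahnSeries.coeff_neg, LinearMap.smul_apply]
    split_ifs with hj
    · rw [hP x j hj]; ring
    · rw [hQ x j (by omega)] at hs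
      rw [hs]
      ring
  have hfin : lieBr (Adc (gp t) L0) (Rop ∘ₗ (lamZ k • Adc (gp t) L0)) =
      conv gp' (conv L0 (charInv (gp t))) +
        conv (gp t) (conv 0 (charInv (gp t)) + conv L0 (charInv gp')) := by
    rw [hM]
    apply cv_inj
    rw [cv_add, cv_conv, cv_conv] at e2
    rw [lieBr, cv_sub, cv_conv, cv_conv, cv_sub, cv_neg, cv_smul, cv_conv, cv_Adc, cv_add, cv_conv,
      cv_conv, cv_conv, cv_add, cv_conv, cv_conv, cv_zero]
    rw [cv_zero] at e2
    have h3 := cv_charInv (hgpchar t)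
    have h4 := cv_charInv' (hgpchar t)
    have hc := cv_central (H := H) (lamZ k) (cv (gp t) * (cv L0 * cv (charInv (gp t))))
    clear e1 d1 d2 dL
    generalize cv (lamZ k • (epsA : H →ₗ[ℂ] LS)) = Λ at *
    generalize cv L0 = l at *
    generalize cv (gp t) = a at *
    generalize cv (charInv (gp t)) = a' at *
    generalize cv gp' = p at *
    generalize cv (charInv gp') = p' at *
    have e3 : p' = -(a' * (p * a')) := by
      have : a' * (p * a' + a * p') = 0 := by rw [e2, mul_zero]
      rw [mul_add, ← mul_assoc a' a, h4, one_mul] at this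
      exact eq_neg_of_add_eq_zero_right this
    have h5 : ∀ z, a' * (a * z) = z := fun z => by rw [← mul_assoc, h4, one_mul]
    rw [e3, mul_sub, sub_mul, ← mul_assoc (a * (l * a')) Λ, hc]
    simp only [mul_neg, neg_mul, zero_mul, zero_add, mul_assoc, h5]
    abel
  rw [hfin]
  exact dL

end Main

end Helpers

/-- **Corollary (Lax pair for the Casimirs `ψ_{m,n}`).**
Let `H` be a connected graded commutative Hopf algebra, `L₀ ∈ g_A`, and
`X = 2λ^{−n+2m}L₀`.  If `g_± : ℝ → G_A` are pointwise differentiable curves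
with `g_±(0) = ε` furnishing the Birkhoff factorization
`exp(−tX) = g₋(t)⁻¹ ⋆ g₊(t)`, then `L(t) := Ad(g_±(t))L₀` satisfies
`dL/dt = [L, M]` with `M = R(λ^{−n+2m}L)`. -/
theorem lax_pair_flow_hopf_casimir
    {H : Type} [CommRing H] [HopfAlgebra ℂ H]
    (𝒜 : ℕ → Submodule ℂ H) [GradedAlgebra 𝒜]
    (hconn : IsConnectedGrading 𝒜) (hΔ : ComulGraded 𝒜)
    (hcounit : CounitGraded 𝒜) (hS : AntipodeGraded 𝒜)
    (m n : ℤ)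
    (L0 : H →ₗ[ℂ] LS) (hL0 : IsInfChar L0)
    (gm gp : ℝ → (H →ₗ[ℂ] LS))
    (hgmchar : ∀ t, IsCharacter (gm t)) (hgpchar : ∀ t, IsCharacter (gp t))
    (hgm0 : gm 0 = epsA) (hgp0 : gp 0 = epsA)
    (hgpplus : ∀ t x, Aplus (gp t x))
    (hgmminus : ∀ t x, Aminus (gm t x - epsA x))
    (hdm : PointwiseDifferentiable gm) (hdp : PointwiseDifferentiable gp)
    (hfact : ∀ t : ℝ,
      IsConvExp ((-(t : ℂ)) • ((2 : ℂ) • (lamZ (-n + 2 * m) • L0)))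
        (conv (charInv (gm t)) (gp t))) :
    (∀ t : ℝ, Adc (gm t) L0 = Adc (gp t) L0) ∧
    ∀ t : ℝ, HasDerivAtF (fun s : ℝ => Adc (gp s) L0)
      (lieBr (Adc (gp t) L0)
        (Rop ∘ₗ (lamZ (-n + 2 * m) • Adc (gp t) L0))) t := by
  exact lax_aux (-n + 2 * m) L0 gm gp hgmchar hgpchar hgpplus hgmminus hdm hdp hfact

end
end

section
/- Let H be a graded connected Hopf algebra over ℂ and φ ∈ G_A a local character with Birkhoff decomposition φ = φ_-^{-1}⋆φ_+. Let φ_+(0) denote the ℂ-valued character x ↦ (φ_+(x))(λ=0) and tildeβ_φ|_{λ=0} the ℂ-valued infinitesimal character x ↦ (tildeβ_φ(x))(λ=0) (well defined since tildeβ_φ is holomorphic). Then β_φ = Ad(φ_+(0))(tildeβ_φ|_{λ=0}) = φ_+(0) ⋆ (tildeβ_φ|_{λ=0}) ⋆ φ_+(0)^{-1}. -/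
open scoped TensorProduct

set_option synthInstance.maxHeartbeats 1000000
set_option maxHeartbeats 1600000
set_option linter.unnecessarySeqFocus false

noncomputable section

/-- The coefficient of `λ^n`, as a linear functional on Laurent series. -/
def coeffL (n : ℤ) : LS →ₗ[ℂ] ℂ where
  toFun f := f.coeff n
  map_add' f g := by simp
  map_smul' c f := by simp

section Helpers

open Coalgebra

lemma aplus_iff (f : LS) : Aplus f ↔ ∃ p : PowerSeries ℂ, HahnSeries.ofPowerSeries ℤ ℂ p = f := by
  constructor
  · intro h
    refine ⟨PowerSeries.mk fun n => f.coeff n, ?_⟩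
    ext n
    rw [PowerSeries.coeff_coe]
    split_ifs with hn
    · exact (h n hn).symm
    · rw [PowerSeries.coeff_mk, Int.natAbs_of_nonneg (by omega)]
  · rintro ⟨p, rfl⟩ n hn
    rw [PowerSeries.coeff_coe, if_pos hn]

lemma aplus_mul {a b : LS} (ha : Aplus a) (hb : Aplus b) : Aplus (a * b) := by
  rw [aplus_iff] at *
  obtain ⟨p, rfl⟩ := ha
  obtain ⟨q, rfl⟩ := hb
  exact ⟨p * q, map_mul _ _ _⟩

lemma coeff_zero_mul {a b : LS} (ha : Aplus a) (hb : Aplus b) :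
    (a * b).coeff 0 = a.coeff 0 * b.coeff 0 := by
  rw [aplus_iff] at *
  obtain ⟨p, rfl⟩ := ha
  obtain ⟨q, rfl⟩ := hb
  rw [← map_mul, PowerSeries.coeff_coe, PowerSeries.coeff_coe, PowerSeries.coeff_coe]
  simp

lemma aplus_sum {ι : Type*} (s : Finset ι) (f : ι → LS) (h : ∀ i ∈ s, Aplus (f i)) :
    Aplus (∑ i ∈ s, f i) := by
  intro n hn
  rw [HahnSeries.coeff_sum]
  exact Finset.sum_eq_zero fun i hi => h i hi n hn

lemma aminus_mul {a b : LS} (ha : Aminus a) (hb : Aminus b) (n : ℤ) (hn : -1 ≤ n) :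
    (a * b).coeff n = 0 := by
  rw [HahnSeries.coeff_mul]
  refine Finset.sum_eq_zero fun p hp => ?_
  rw [Finset.mem_addAntidiagonal] at hp
  by_cases h : 0 ≤ p.1
  · rw [ha _ h, zero_mul]
  · rw [hb p.2 (by omega), mul_zero]

lemma lam_mul_coeff (f : LS) (n : ℤ) : (lam * f).coeff n = f.coeff (n - 1) := by
  have := HahnSeries.coeff_single_mul_add (r := (1 : ℂ)) (x := f) (a := n - 1) (b := (1 : ℤ))
  rw [sub_add_cancel, one_mul] at this
  exact this

lemma expL_zero : expL 0 = 1 := by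
  have : (PowerSeries.mk fun k => (0 : ℂ) ^ k / (k.factorial : ℂ)) = 1 := by
    ext n
    rw [PowerSeries.coeff_mk, PowerSeries.coeff_one]
    split_ifs with h
    · simp [h]
    · simp [h]
  rw [expL, this, map_one]

lemma hasDerivAt_expL_ps (c : ℂ) (p : PowerSeries ℂ) (n : ℕ) :
    HasDerivAt (fun t : ℂ => PowerSeries.coeff n
      ((PowerSeries.mk fun k => (t * c) ^ k / (k.factorial : ℂ)) * p))
      (PowerSeries.coeff n (PowerSeries.C c * PowerSeries.X * p)) 0 := by
  have key : ∀ k : ℕ, HasDerivAt (fun t : ℂ => (t * c) ^ k / (k.factorial : ℂ))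
      (PowerSeries.coeff k (PowerSeries.C c * PowerSeries.X)) 0 := by
    intro k
    have h1 := (((hasDerivAt_id (0 : ℂ)).mul_const c).pow k).div_const (k.factorial : ℂ)
    have h2 : PowerSeries.coeff k (PowerSeries.C c * PowerSeries.X) =
        (k : ℂ) * (id 0 * c) ^ (k - 1) * (1 * c) / (k.factorial : ℂ) := by
      rw [PowerSeries.coeff_C_mul, PowerSeries.coeff_X]
      rcases k with _ | _ | k
      · simp
      · simp
      · simp
    rw [h2]
    exact h1
  simp only [PowerSeries.coeff_mul n, PowerSeries.coeff_mk]
  refine HasDerivAt.fun_sum fun i _ => ?_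
  exact (key i.1).mul_const _

lemma hasDerivAt_expL (c : ℂ) (f : LS) (n : ℤ) :
    HasDerivAt (fun t : ℂ => (expL (t * c) * f).coeff n) ((c • (lam * f)).coeff n) 0 := by
  obtain ⟨m, p, rfl⟩ : ∃ (m : ℤ) (p : PowerSeries ℂ),
      HahnSeries.single m 1 * HahnSeries.ofPowerSeries ℤ ℂ p = f :=
    ⟨_, _, f.single_order_mul_powerSeriesPart⟩
  have h1 : ∀ q : PowerSeries ℂ, (HahnSeries.single m (1 : ℂ) *
      HahnSeries.ofPowerSeries ℤ ℂ q).coeff n =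
      if n - m < 0 then 0 else PowerSeries.coeff (n - m).natAbs q := by
    intro q
    have := HahnSeries.coeff_single_mul_add (r := (1 : ℂ))
      (x := HahnSeries.ofPowerSeries ℤ ℂ q) (a := n - m) (b := m)
    rw [sub_add_cancel, one_mul] at this
    rw [this, PowerSeries.coeff_coe]
  have h2 : ∀ t : ℂ, expL (t * c) * (HahnSeries.single m 1 * HahnSeries.ofPowerSeries ℤ ℂ p) =
      HahnSeries.single m 1 * HahnSeries.ofPowerSeries ℤ ℂ
        ((PowerSeries.mk fun k => (t * c) ^ k / (k.factorial : ℂ)) * p) := by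
    intro t
    rw [map_mul, expL]
    ring
  have h3 : c • (lam * (HahnSeries.single m 1 * HahnSeries.ofPowerSeries ℤ ℂ p)) =
      HahnSeries.single m 1 * HahnSeries.ofPowerSeries ℤ ℂ
        (PowerSeries.C c * PowerSeries.X * p) := by
    rw [map_mul, map_mul, HahnSeries.ofPowerSeries_X, HahnSeries.ofPowerSeries_C,
      ← HahnSeries.single_zero_mul_eq_smul, lam, HahnSeries.C_apply]
    ring
  simp only [h2, h3, h1]
  split_ifs with h
  · exact hasDerivAt_const _ _
  · exact hasDerivAt_expL_ps c p _

variable {H : Type} [Ring H] [HopfAlgebra ℂ H]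

lemma conv_apply (f g : H →ₗ[ℂ] LS) (x : H) :
    conv f g x = ∑ i ∈ (ℛ ℂ x).index, f ((ℛ ℂ x).left i) * g ((ℛ ℂ x).right i) := by
  simp [conv, ← (ℛ ℂ x).eq]

lemma convC_apply (f g : H →ₗ[ℂ] ℂ) (x : H) :
    convC f g x = ∑ i ∈ (ℛ ℂ x).index, f ((ℛ ℂ x).left i) * g ((ℛ ℂ x).right i) := by
  simp [convC, ← (ℛ ℂ x).eq]

lemma epsA_apply (x : H) : epsA x = counit (R := ℂ) x • (1 : LS) := by
  simp [epsA]

lemma conv_assoc (f g h : H →ₗ[ℂ] LS) : conv (conv f g) h = conv f (conv g h) :=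
  congrArg WithConv.ofConv
    (mul_assoc (WithConv.toConv f) (WithConv.toConv g) (WithConv.toConv h))

lemma conv_eps (f : H →ₗ[ℂ] LS) : conv f epsA = f := by
  ext1 x
  rw [conv_apply]
  have hx := congrArg (TensorProduct.rid ℂ H) (sum_tmul_counit_eq (ℛ ℂ x))
  simp only [map_sum, TensorProduct.rid_tmul, one_smul] at hx
  conv_rhs => rw [← hx, map_sum]
  refine Finset.sum_congr rfl fun i _ => ?_
  rw [epsA_apply, mul_smul_comm, mul_one, map_smul]

lemma eps_conv (f : H →ₗ[ℂ] LS) : conv epsA f = f := by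
  ext1 x
  rw [conv_apply]
  conv_rhs => rw [← sum_counit_smul (ℛ ℂ x), map_sum]
  refine Finset.sum_congr rfl fun i _ => ?_
  rw [epsA_apply, smul_mul_assoc, one_mul, map_smul]

lemma conv_charInv {f : H →ₗ[ℂ] LS} (hf : IsCharacter f) : conv f (charInv f) = epsA := by
  ext1 x
  rw [conv_apply, epsA_apply, ← hf.1, ← map_smul,
    ← HopfAlgebra.sum_mul_antipode_eq_smul (ℛ ℂ x), map_sum]
  simp [charInv, hf.2]

lemma charInv_conv {f : H →ₗ[ℂ] LS} (hf : IsCharacter f) : conv (charInv f) f = epsA := by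
  ext1 x
  rw [conv_apply, epsA_apply, ← hf.1, ← map_smul,
    ← HopfAlgebra.sum_antipode_mul_eq_smul (ℛ ℂ x), map_sum]
  simp [charInv, hf.2]

lemma aplus_conv {f g : H →ₗ[ℂ] LS} (hf : ∀ x, Aplus (f x)) (hg : ∀ x, Aplus (g x)) (x : H) :
    Aplus (conv f g x) := by
  rw [conv_apply]
  exact aplus_sum _ _ fun i _ => aplus_mul (hf _) (hg _)

lemma coeff_zero_conv {f g : H →ₗ[ℂ] LS} (hf : ∀ x, Aplus (f x)) (hg : ∀ x, Aplus (g x)) :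
    coeffL 0 ∘ₗ conv f g = convC (coeffL 0 ∘ₗ f) (coeffL 0 ∘ₗ g) := by
  ext1 x
  rw [convC_apply, LinearMap.comp_apply, conv_apply, map_sum]
  exact Finset.sum_congr rfl fun i _ => coeff_zero_mul (hf _) (hg _)

/-- Product of two pure-pole maps has no coefficients in degree at least `-1`. -/
lemma aminus_conv {f g : H →ₗ[ℂ] LS} (hf : ∀ x, Aminus (f x)) (hg : ∀ x, Aminus (g x)) (x : H)
    (n : ℤ) (hn : -1 ≤ n) : (conv f g x).coeff n = 0 := by
  rw [conv_apply, HahnSeries.coeff_sum]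
  exact Finset.sum_eq_zero fun i _ => aminus_mul (hf _) (hg _) n hn

lemma conv_add_left (f g h : H →ₗ[ℂ] LS) : conv (f + g) h = conv f h + conv g h := by
  ext1 x
  simp [conv_apply, add_mul, Finset.sum_add_distrib]

lemma conv_add_right (f g h : H →ₗ[ℂ] LS) : conv f (g + h) = conv f g + conv f h := by
  ext1 x
  simp [conv_apply, mul_add, Finset.sum_add_distrib]

lemma lin_sub_add (f g : H →ₗ[ℂ] LS) : f - g + g = f := by
  ext1 x
  rw [LinearMap.add_apply, LinearMap.sub_apply, sub_add_cancel]

lemma lin_add_sub (f g : H →ₗ[ℂ] LS) : g = f + g - f := by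
  ext1 x
  rw [LinearMap.sub_apply, LinearMap.add_apply, add_sub_cancel_left]

lemma conv_sub_left (f g h : H →ₗ[ℂ] LS) : conv (f - g) h = conv f h - conv g h := by
  ext1 x
  simp [conv_apply, sub_mul, Finset.sum_sub_distrib]

/-- Multiplication by `λ`. -/
def lmul (f : H →ₗ[ℂ] LS) : H →ₗ[ℂ] LS := LinearMap.mulLeft ℂ lam ∘ₗ f

lemma lmul_apply (f : H →ₗ[ℂ] LS) (x : H) : lmul f x = lam * f x := rfl

lemma conv_lmul_left (f g : H →ₗ[ℂ] LS) : conv (lmul f) g = lmul (conv f g) := by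
  ext1 x
  simp [conv_apply, lmul_apply, Finset.mul_sum, mul_assoc]

lemma conv_lmul_right (f g : H →ₗ[ℂ] LS) : conv f (lmul g) = lmul (conv f g) := by
  ext1 x
  simp [conv_apply, lmul_apply, Finset.mul_sum, mul_left_comm]

lemma lmul_sub (f g : H →ₗ[ℂ] LS) : lmul (f - g) = lmul f - lmul g := by
  ext1 x
  simp [lmul_apply, mul_sub]

lemma aminus_charInv {f : H →ₗ[ℂ] LS} (hf : ∀ x, Aminus (f x - epsA x)) (x : H) :
    Aminus (charInv f x - epsA x) := by
  have := hf (HopfAlgebra.antipode ℂ x)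
  rwa [epsA_apply, HopfAlgebra.counit_antipode, ← epsA_apply] at this

lemma aplus_charInv {f : H →ₗ[ℂ] LS} (hf : ∀ x, Aplus (f x)) (x : H) :
    Aplus (charInv f x) := hf _

lemma birkhoff_unique {φ m p m' p' : H →ₗ[ℂ] LS} (h : IsBirkhoff φ m p)
    (h' : IsBirkhoff φ m' p') (hφ : IsCharacter φ) : m = m' := by
  obtain ⟨hm, hp, hpp, hmm, he⟩ := h
  obtain ⟨hm', hp', hpp', hmm', he'⟩ := h'
  have e1 : conv m (charInv m') = conv p (charInv p') := by
    have h1 : φ = conv (charInv m') p' := by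
      rw [← he', ← conv_assoc, charInv_conv hm', eps_conv]
    rw [← he, h1, conv_assoc, conv_assoc, conv_charInv hp', conv_eps]
  have e2 : conv m (charInv m') = epsA := by
    ext1 x
    ext n
    by_cases hn : n < 0
    · rw [e1, aplus_conv hpp (aplus_charInv hpp') x n hn, epsA_apply]
      simp [HahnSeries.coeff_one, hn.ne]
    · push Not at hn
      have e3 : conv m (charInv m') = conv (m - epsA) (charInv m' - epsA) + (m - epsA)
          + (charInv m' - epsA) + epsA := by
        have a1 : conv m (charInv m') =
          conv ((m - epsA) + epsA) ((charInv m' - epsA) + epsA) := by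
          rw [lin_sub_add, lin_sub_add]
        rw [a1, conv_add_left, conv_add_right, conv_eps, eps_conv, add_assoc _ _ epsA]
      rw [e3]
      have b1 := aminus_conv (f := m - epsA) (g := charInv m' - epsA) hmm
        (aminus_charInv hmm') x n (by omega)
      have b2 := hmm x n hn
      have b3 := aminus_charInv hmm' x n hn
      simp only [LinearMap.add_apply, LinearMap.sub_apply, HahnSeries.coeff_add,
        HahnSeries.coeff_sub] at *
      rw [b1, b2, b3]
      simp
  rw [← conv_eps m, ← charInv_conv hm', ← conv_assoc, e2, eps_conv]

variable (𝒜 : ℕ → Submodule ℂ H) [GradedAlgebra 𝒜]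

lemma charScale_of_mem (t : ℂ) (φ : H →ₗ[ℂ] LS) (k : ℕ) (x : H) (hx : x ∈ 𝒜 k) :
    charScale 𝒜 t φ x = expL (t * k) * φ x := by
  lift x to 𝒜 k using hx
  rw [charScale, LinearMap.comp_apply, LinearEquiv.coe_coe,
    DirectSum.decomposeLinearEquiv_apply, DirectSum.decompose_coe]
  exact DFinsupp.lsum_single _ _ _ _

lemma Ymap_of_mem (k : ℕ) (x : H) (hx : x ∈ 𝒜 k) : Ymap 𝒜 x = (k : ℂ) • x := by
  lift x to 𝒜 k using hx
  rw [Ymap, LinearMap.comp_apply, LinearEquiv.coe_coe,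
    DirectSum.decomposeLinearEquiv_apply, DirectSum.decompose_coe]
  exact DFinsupp.lsum_single _ _ _ _

lemma charScale_zero (φ : H →ₗ[ℂ] LS) : charScale 𝒜 0 φ = φ := by
  ext1 x
  induction x using DirectSum.Decomposition.inductionOn 𝒜 with
  | zero => simp
  | homogeneous m => rw [charScale_of_mem 𝒜 0 φ _ _ m.2, zero_mul, expL_zero, one_mul]
  | add a b ha hb => rw [map_add, map_add, ha, hb]

lemma hasDerivAt_charScale (a : LS) (φ : H →ₗ[ℂ] LS) (x : H) (n : ℤ) :
    HasDerivAt (fun t : ℂ => (a * charScale 𝒜 t φ x).coeff n)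
      ((a * lmul (φ ∘ₗ Ymap 𝒜) x).coeff n) 0 := by
  induction x using DirectSum.Decomposition.inductionOn 𝒜 with
  | zero => simpa using hasDerivAt_const _ _
  | @homogeneous i m =>
    have := hasDerivAt_expL i (a * φ m) n
    simp only [charScale_of_mem 𝒜 _ φ _ _ m.2, lmul_apply, LinearMap.comp_apply,
      Ymap_of_mem 𝒜 _ _ m.2, map_smul, mul_smul_comm]
    simpa only [mul_left_comm a] using this
  | add p q hp hq =>
    simp only [map_add, mul_add, HahnSeries.coeff_add]
    exact hp.add hq

lemma hasDerivAt_conv (f φ : H →ₗ[ℂ] LS) (x : H) (n : ℤ) :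
    HasDerivAt (fun t : ℂ => (conv f (charScale 𝒜 t φ) x).coeff n)
      ((conv f (lmul (φ ∘ₗ Ymap 𝒜)) x).coeff n) 0 := by
  simp only [conv_apply, HahnSeries.coeff_sum]
  exact HasDerivAt.fun_sum fun i _ => hasDerivAt_charScale 𝒜 _ φ _ n

lemma comul_Ymap (hΔ : ComulGraded 𝒜) (x : H) :
    comul (R := ℂ) (Ymap 𝒜 x) =
      (TensorProduct.map (Ymap 𝒜) LinearMap.id + TensorProduct.map LinearMap.id (Ymap 𝒜) :
        H ⊗[ℂ] H →ₗ[ℂ] H ⊗[ℂ] H) (comul (R := ℂ) x) := by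
  induction x using DirectSum.Decomposition.inductionOn 𝒜 with
  | zero => simp
  | @homogeneous n m =>
    rw [Ymap_of_mem 𝒜 _ _ m.2, map_smul]
    have h := hΔ n m m.2
    have hle : (⨆ p : {p : ℕ × ℕ // p.1 + p.2 = n},
        LinearMap.range (TensorProduct.map ((𝒜 p.1.1).subtype) ((𝒜 p.1.2).subtype))) ≤
        LinearMap.eqLocus ((n : ℂ) • (LinearMap.id : H ⊗[ℂ] H →ₗ[ℂ] H ⊗[ℂ] H))
          (TensorProduct.map (Ymap 𝒜) LinearMap.id +
            TensorProduct.map LinearMap.id (Ymap 𝒜)) := by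
      refine iSup_le ?_
      rintro ⟨⟨i, j⟩, hij⟩ _ ⟨z, rfl⟩
      induction z with
      | zero => simp
      | add a b ha hb => rw [map_add]; exact Submodule.add_mem _ ha hb
      | tmul a b =>
        simp only [LinearMap.mem_eqLocus, TensorProduct.map_tmul, LinearMap.smul_apply,
          LinearMap.add_apply, LinearMap.id_apply, Submodule.subtype_apply]
        rw [Ymap_of_mem 𝒜 _ _ a.2, Ymap_of_mem 𝒜 _ _ b.2, TensorProduct.smul_tmul',
          TensorProduct.tmul_smul, ← TensorProduct.smul_tmul', ← TensorProduct.smul_tmul',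
          ← add_smul]
        congr 1
        exact_mod_cast hij.symm
    exact hle h
  | add a b ha hb => simp only [map_add, ha, hb]

lemma conv_comp_Ymap (hΔ : ComulGraded 𝒜) (f g : H →ₗ[ℂ] LS) :
    conv f g ∘ₗ Ymap 𝒜 = conv (f ∘ₗ Ymap 𝒜) g + conv f (g ∘ₗ Ymap 𝒜) := by
  ext1 x
  have : conv f g (Ymap 𝒜 x) = LinearMap.mul' ℂ LS (TensorProduct.map f g
    (comul (R := ℂ) (Ymap 𝒜 x))) := rfl
  rw [LinearMap.comp_apply, this, comul_Ymap 𝒜 hΔ, ← (ℛ ℂ x).eq, LinearMap.add_apply (conv _ _),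
    conv_apply, conv_apply]
  simp [Finset.sum_add_distrib]

lemma epsA_Ymap (hcounit : CounitGraded 𝒜) (x : H) : epsA (Ymap 𝒜 x) = 0 := by
  induction x using DirectSum.Decomposition.inductionOn 𝒜 with
  | zero => simp
  | @homogeneous n m =>
    rw [Ymap_of_mem 𝒜 _ _ m.2, map_smul, epsA_apply]
    ext k
    rw [HahnSeries.coeff_smul, HahnSeries.coeff_smul, HahnSeries.coeff_zero]
    rcases Nat.eq_zero_or_pos n with rfl | hn
    · simp
    · simp [hcounit n hn m m.2]
  | add a b ha hb => rw [map_add, map_add, ha, hb, add_zero]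

end Helpers

/-- **Lemma.** Let `φ` be a local character with Birkhoff decomposition
`φ = φ₋⁻¹ ⋆ φ₊` and beta character `tildeβ_φ = B`.  Let `φ₊(0)` denote the
`ℂ`-valued character `x ↦ (φ₊(x))(λ=0)` and `tildeβ_φ|₀` the `ℂ`-valued
infinitesimal character `x ↦ (tildeβ_φ(x))(λ=0)`.  Then
`β_φ = Ad(φ₊(0))(tildeβ_φ|₀) = φ₊(0) ⋆ (tildeβ_φ|₀) ⋆ φ₊(0)⁻¹`, where
`β_φ = −(Res φ₋)∘Y`. -/
theorem beta_eq_Ad_of_tildeBeta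
    {H : Type} [Ring H] [HopfAlgebra ℂ H]
    (𝒜 : ℕ → Submodule ℂ H) [GradedAlgebra 𝒜]
    (hconn : IsConnectedGrading 𝒜) (hΔ : ComulGraded 𝒜)
    (hcounit : CounitGraded 𝒜) (hS : AntipodeGraded 𝒜)
    (φ φm φp B : H →ₗ[ℂ] LS)
    (hloc : IsLocal 𝒜 φ) (hbk : IsBirkhoff φ φm φp)
    (hB : HasTildeBeta 𝒜 φ B) :
    -(coeffL (-1) ∘ₗ (φm ∘ₗ Ymap 𝒜)) =
      convC (coeffL 0 ∘ₗ φp)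
        (convC (coeffL 0 ∘ₗ B) (charInvC (coeffL 0 ∘ₗ φp))) := by
  obtain ⟨hφ, m', hm'⟩ := hloc
  have hmeq : φm = m' := by
    obtain ⟨p0, h0⟩ := hm' 0
    rw [charScale_zero] at h0
    exact birkhoff_unique hbk h0 hφ
  subst hmeq
  obtain ⟨hm, hp, hpp, hmm, he⟩ := hbk
  have hBeq : B = conv (charInv φ) (lmul (φ ∘ₗ Ymap 𝒜)) := by
    ext1 x
    ext n
    exact (hB x n).unique (hasDerivAt_conv 𝒜 _ φ x n)
  have hpB : conv φp B = conv φm (lmul (φ ∘ₗ Ymap 𝒜)) := by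
    rw [hBeq, ← he, conv_assoc, ← conv_assoc φ, conv_charInv hφ, eps_conv]
  have hpBplus : ∀ x, Aplus (conv φp B x) := by
    intro x n hn
    rw [hpB]
    refine (hasDerivAt_conv 𝒜 φm φ x n).unique ?_
    have : (fun t : ℂ => (conv φm (charScale 𝒜 t φ) x).coeff n) = fun _ => 0 := by
      funext t
      obtain ⟨pt, _, _, h3, _, h5⟩ := hm' t
      rw [h5]
      exact h3 x n hn
    rw [this]
    exact hasDerivAt_const _ _
  have hBplus : ∀ x, Aplus (B x) := by
    have : B = conv (charInv φp) (conv φp B) := by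
      rw [← conv_assoc, charInv_conv hp, eps_conv]
    rw [this]
    exact aplus_conv (aplus_charInv hpp) hpBplus
  have hinv : charInvC (coeffL 0 ∘ₗ φp) = coeffL 0 ∘ₗ charInv φp := rfl
  rw [hinv, ← coeff_zero_conv hBplus (aplus_charInv hpp),
    ← coeff_zero_conv hpp (aplus_conv hBplus (aplus_charInv hpp)), ← conv_assoc, hpB,
    conv_lmul_right]
  have hY : conv φm (φ ∘ₗ Ymap 𝒜) = φp ∘ₗ Ymap 𝒜 - conv (φm ∘ₗ Ymap 𝒜) φ := by
    rw [← he, conv_comp_Ymap 𝒜 hΔ]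
    exact lin_add_sub _ _
  have hφp : conv φ (charInv φp) = charInv φm := by
    have : φ = conv (charInv φm) φp := by
      rw [← he, ← conv_assoc, charInv_conv hm, eps_conv]
    rw [this, conv_assoc, conv_charInv hp, conv_eps]
  rw [hY, conv_lmul_left, conv_sub_left, conv_assoc, hφp]
  ext1 x
  have c1 : (conv (φp ∘ₗ Ymap 𝒜) (charInv φp) x).coeff (-1) = 0 :=
    aplus_conv (f := φp ∘ₗ Ymap 𝒜) (fun y => hpp _) (aplus_charInv hpp) x (-1) (by norm_num)
  have hmY : ∀ y, Aminus ((φm ∘ₗ Ymap 𝒜) y) := by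
    intro y
    have := hmm (Ymap 𝒜 y)
    rwa [epsA_Ymap 𝒜 hcounit, sub_zero] at this
  have c2 := aminus_conv (g := charInv φm - epsA) hmY (aminus_charInv hmm) x (-1) le_rfl
  have c3 : conv (φm ∘ₗ Ymap 𝒜) (charInv φm) =
      conv (φm ∘ₗ Ymap 𝒜) (charInv φm - epsA) + φm ∘ₗ Ymap 𝒜 := by
    have h1 := conv_add_right (φm ∘ₗ Ymap 𝒜) (charInv φm - epsA) epsA
    rwa [conv_eps, lin_sub_add] at h1
  have c4 : ∀ (n : ℤ) (f : LS), coeffL n f = f.coeff n := fun _ _ => rfl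
  simp only [LinearMap.neg_apply, LinearMap.comp_apply, c4, lmul_apply, lam_mul_coeff,
    LinearMap.sub_apply, HahnSeries.coeff_sub, zero_sub, c1]
  rw [c3, LinearMap.add_apply, HahnSeries.coeff_add, c2, zero_add]
  rfl

end
end
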